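/- For d = 6, the Poincaré series of the algebra of covariants of the binary 6-form satisfies P_6(z) = p_6(z)/((1 − z)(1 − z²)²(1 − z³)(1 − z⁴)(1 − z⁵)), where p_6(z) = z^{10} + z^8 + 3z^7 + 4z^6 + 4z^5 + 4z^4 + 3z^3 + z^2 + 1; i.e. ∑_{n≥0} dim(S_n) z^n = p_6(z) · ((1 − z)(1 − z²)²(1 − z³)(1 − z⁴)(1 − z⁵))^{−1} in ℂ[[z]]. -/

import Mathlib

noncomputable section

/-- The derivation D₁ on ℂ[x_0,…,x_d] with D₁(x_0)=0 and D₁(x_i)=i·x_{i-1}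
(for i = 0 the coefficient i vanishes, so the wrap-around in `Fin` is harmless). -/
def D1 (d : ℕ) :
    Derivation ℂ (MvPolynomial (Fin (d + 1)) ℂ) (MvPolynomial (Fin (d + 1)) ℂ) :=
  MvPolynomial.mkDerivation ℂ (fun i => (i.val : ℂ) • MvPolynomial.X (i - 1))

/-- S_n: the space of homogeneous degree-n seminvariants of the binary d-form. -/
def Sn (d n : ℕ) : Submodule ℂ (MvPolynomial (Fin (d + 1)) ℂ) :=
  MvPolynomial.homogeneousSubmodule (Fin (d + 1)) ℂ n ⊓ LinearMap.ker (D1 d).toLinearMap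

/-- The Poincaré series P_d(z) = ∑_{n≥0} dim(S_n) zⁿ of the algebra of covariants. -/
def PSeries (d : ℕ) : PowerSeries ℂ :=
  PowerSeries.mk fun n => (Module.finrank ℂ (Sn d n) : ℂ)

namespace MvPolynomial

section Weights

variable {R σ M : Type*} [CommSemiring R] [AddCommMonoid M] {w : σ → M} {f : σ → MvPolynomial σ R}

/-- A derivation of `MvPolynomial σ R` that shifts the weight of each variable by `k` shifts the
weight of every weighted homogeneous polynomial by `k`. -/
theorem IsWeightedHomogeneous.mkDerivation {k n : M}
    (hf : ∀ i, (f i).IsWeightedHomogeneous w (w i + k)) {p : MvPolynomial σ R}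
    (hp : p.IsWeightedHomogeneous w n) :
    (mkDerivation R f p).IsWeightedHomogeneous w (n + k) := by
  rw [← p.support_sum_monomial_coeff, map_sum]
  refine IsWeightedHomogeneous.sum _ _ _ fun s hs => ?_
  rw [mkDerivation_monomial]
  refine (weightedHomogeneousSubmodule R w _).smul_mem _ (IsWeightedHomogeneous.sum _ _ _ ?_)
  intro i hi
  have hw := Finsupp.weight_sub_single_add (w := w) (Finsupp.mem_support_iff.1 hi)
  rw [← hp (mem_support_iff.1 hs), ← hw, add_assoc]
  exact (isWeightedHomogeneous_monomial w _ _ rfl).mul (hf i)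

/-- A derivation shifting weights by `k` commutes, up to this shift, with taking weighted
homogeneous components. -/
theorem mkDerivation_weightedHomogeneousComponent [IsRightCancelAdd M] {k : M}
    (hf : ∀ i, (f i).IsWeightedHomogeneous w (w i + k)) (n : M) (p : MvPolynomial σ R) :
    mkDerivation R f (weightedHomogeneousComponent w n p) =
      weightedHomogeneousComponent w (n + k) (mkDerivation R f p) := by
  classical
  induction p using MvPolynomial.induction_on' with
  | add p q hp hq => simp only [map_add, hp, hq]
  | monomial s a =>
    have hs : (monomial s a).IsWeightedHomogeneous w (Finsupp.weight w s) :=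
      isWeightedHomogeneous_monomial w _ _ rfl
    rw [weightedHomogeneousComponent_of_mem hs,
      weightedHomogeneousComponent_of_mem (hs.mkDerivation hf), add_left_inj]
    split_ifs
    · rfl
    · exact map_zero _

theorem mkDerivation_weight_smul_X_apply {n : M} {r : M →+ R}
    {p : MvPolynomial σ R} (hp : p.IsWeightedHomogeneous w n) :
    mkDerivation R (fun i => r (w i) • (X i : MvPolynomial σ R)) p = r n • p := by
  conv_lhs => rw [← p.support_sum_monomial_coeff]
  conv_rhs => rw [← p.support_sum_monomial_coeff]
  rw [map_sum, Finset.smul_sum]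
  refine Finset.sum_congr rfl fun s hs => ?_
  rw [mkDerivation_monomial, ← hp (mem_support_iff.1 hs), Finsupp.weight_apply, Finsupp.sum,
    Finsupp.sum, map_sum, Finset.sum_smul, Finset.smul_sum]
  refine Finset.sum_congr rfl fun i hi => ?_
  have hs1 : Finsupp.single i 1 ≤ s := by
    simpa [Finsupp.single_le_iff, Nat.one_le_iff_ne_zero] using Finsupp.mem_support_iff.1 hi
  rw [smul_eq_mul, mul_smul_comm, X, monomial_mul, tsub_add_cancel_of_le hs1, mul_one,
    map_nsmul, smul_monomial, smul_monomial, smul_monomial]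
  congr 1
  simp only [smul_eq_mul, nsmul_eq_mul]
  ring

end Weights

theorem finrank_restrictSupport {R σ : Type*} [CommRing R] [StrongRankCondition R]
    (s : Finset (σ →₀ ℕ)) :
    Module.finrank R (restrictSupport R (s : Set (σ →₀ ℕ))) = s.card := by
  rw [Module.finrank_eq_card_basis (basisRestrictSupport R (s : Set (σ →₀ ℕ)))]
  simp

end MvPolynomial

open MvPolynomial in
/-- The derivation `x_i ↦ (d - i) x_{i+1}`, which together with `D1 d` generates the action of
`sl₂` on the polynomial functions on binary `d`-forms. -/
def raisingDerivation (d : ℕ) :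
    Derivation ℂ (MvPolynomial (Fin (d + 1)) ℂ) (MvPolynomial (Fin (d + 1)) ℂ) :=
  mkDerivation ℂ fun i => ((d : ℂ) - (i.val : ℂ)) • X (i + 1)

/-- The weight `d - 2 i` of the variable `x_i`. -/
def formWeight (d : ℕ) (i : Fin (d + 1)) : ℤ := d - 2 * i.val

section Sl2

open MvPolynomial

variable {d n : ℕ} {h : ℤ} {p : MvPolynomial (Fin (d + 1)) ℂ}

theorem val_smul_X_isWeightedHomogeneous (i : Fin (d + 1)) :
    ((i.val : ℂ) • (X (i - 1) : MvPolynomial (Fin (d + 1)) ℂ)).IsWeightedHomogeneous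
      (formWeight d) (formWeight d i + 2) := by
  rcases eq_or_ne i 0 with rfl | hi
  · simpa using isWeightedHomogeneous_zero ℂ _ _
  · have hw : formWeight d i + 2 = formWeight d (i - 1) := by
      have := Fin.val_ne_zero_iff.2 hi
      simp only [formWeight, Fin.coe_sub_one, hi, if_false]
      omega
    rw [hw]
    exact (weightedHomogeneousSubmodule ℂ _ _).smul_mem _ (isWeightedHomogeneous_X ℂ _ _)

theorem sub_val_smul_X_isWeightedHomogeneous (i : Fin (d + 1)) :
    (((d : ℂ) - (i.val : ℂ)) • (X (i + 1) : MvPolynomial (Fin (d + 1)) ℂ)).IsWeightedHomogeneous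
      (formWeight d) (formWeight d i + -2) := by
  rcases eq_or_ne i (Fin.last d) with rfl | hi
  · simpa using isWeightedHomogeneous_zero ℂ _ _
  · have hw : formWeight d i + -2 = formWeight d (i + 1) := by
      simp only [formWeight, Fin.val_add_one, hi, if_false]
      omega
    rw [hw]
    exact (weightedHomogeneousSubmodule ℂ _ _).smul_mem _ (isWeightedHomogeneous_X ℂ _ _)

theorem D1_isWeightedHomogeneous (hp : p.IsWeightedHomogeneous (formWeight d) h) :
    (D1 d p).IsWeightedHomogeneous (formWeight d) (h + 2) :=
  hp.mkDerivation val_smul_X_isWeightedHomogeneous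

theorem raisingDerivation_isWeightedHomogeneous
    (hp : p.IsWeightedHomogeneous (formWeight d) h) :
    (raisingDerivation d p).IsWeightedHomogeneous (formWeight d) (h + -2) :=
  hp.mkDerivation sub_val_smul_X_isWeightedHomogeneous

theorem D1_isHomogeneous (hp : p.IsHomogeneous n) : (D1 d p).IsHomogeneous n :=
  IsWeightedHomogeneous.mkDerivation (k := 0)
    (fun _ => (homogeneousSubmodule _ ℂ 1).smul_mem _ (isHomogeneous_X ℂ _)) hp

theorem raisingDerivation_isHomogeneous (hp : p.IsHomogeneous n) :
    (raisingDerivation d p).IsHomogeneous n :=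
  IsWeightedHomogeneous.mkDerivation (k := 0)
    (fun _ => (homogeneousSubmodule _ ℂ 1).smul_mem _ (isHomogeneous_X ℂ _)) hp

theorem lie_D1_raisingDerivation (d : ℕ) :
    ⁅D1 d, raisingDerivation d⁆ =
      mkDerivation ℂ fun i => Int.castAddHom ℂ (formWeight d i) • X i := by
  refine derivation_ext fun i => ?_
  rw [Derivation.commutator_apply, D1, raisingDerivation, mkDerivation_X, mkDerivation_X,
    Derivation.map_smul, Derivation.map_smul, mkDerivation_X, mkDerivation_X, mkDerivation_X,
    add_sub_cancel_right, sub_add_cancel, smul_smul, smul_smul, ← sub_smul]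
  congr 1
  have h1 : ((d : ℂ) - i.val) * ((i + 1 : Fin (d + 1)).val : ℂ) = (d - i.val) * (i.val + 1) := by
    rcases eq_or_ne i (Fin.last d) with rfl | hi
    · simp
    · simp [Fin.val_add_one, hi]
  have h2 : (i.val : ℂ) * (d - ((i - 1 : Fin (d + 1)).val : ℂ)) = i.val * (d - (i.val - 1)) := by
    rcases eq_or_ne i 0 with rfl | hi
    · simp
    · have := Nat.one_le_iff_ne_zero.2 (Fin.val_ne_zero_iff.2 hi)
      simp [Fin.coe_sub_one, hi, Nat.cast_sub this]
  rw [h1, h2]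
  simp [formWeight]
  ring

theorem D1_raisingDerivation (hp : p.IsWeightedHomogeneous (formWeight d) h) :
    D1 d (raisingDerivation d p) = raisingDerivation d (D1 d p) + (h : ℂ) • p := by
  have := mkDerivation_weight_smul_X_apply (r := Int.castAddHom ℂ) hp
  rw [← lie_D1_raisingDerivation, Derivation.commutator_apply] at this
  rw [← sub_eq_iff_eq_add', this]
  rfl

theorem D1_iterate_isWeightedHomogeneous (hp : p.IsWeightedHomogeneous (formWeight d) h) (m : ℕ) :
    ((D1 d)^[m] p).IsWeightedHomogeneous (formWeight d) (h + 2 * m) := by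
  induction m with
  | zero => simpa using hp
  | succ m ih =>
    rw [Function.iterate_succ_apply']
    convert D1_isWeightedHomogeneous ih using 1
    push_cast; ring

theorem raisingDerivation_iterate_isWeightedHomogeneous
    (hp : p.IsWeightedHomogeneous (formWeight d) h) (m : ℕ) :
    ((raisingDerivation d)^[m] p).IsWeightedHomogeneous (formWeight d) (h - 2 * m) := by
  induction m with
  | zero => simpa using hp
  | succ m ih =>
    rw [Function.iterate_succ_apply']
    convert raisingDerivation_isWeightedHomogeneous ih using 1
    push_cast; ring

theorem D1_iterate_raisingDerivation (hp : p.IsWeightedHomogeneous (formWeight d) h) (m : ℕ) :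
    (D1 d)^[m + 1] (raisingDerivation d p) =
      raisingDerivation d ((D1 d)^[m + 1] p) + ((m + 1) * (h + m) : ℂ) • (D1 d)^[m] p := by
  induction m with
  | zero => simpa using D1_raisingDerivation hp
  | succ m ih =>
    rw [Function.iterate_succ_apply', ih, map_add, Derivation.map_smul,
      D1_raisingDerivation (D1_iterate_isWeightedHomogeneous hp (m + 1)),
      ← Function.iterate_succ_apply' (D1 d) (m + 1), ← Function.iterate_succ_apply' (D1 d) m,
      add_assoc, ← add_smul]
    congr 2
    push_cast; ring

theorem D1_raisingDerivation_iterate (hp : p.IsWeightedHomogeneous (formWeight d) h)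
    (h0 : D1 d p = 0) (m : ℕ) :
    D1 d ((raisingDerivation d)^[m + 1] p) =
      ((m + 1) * (h - m) : ℂ) • (raisingDerivation d)^[m] p := by
  induction m with
  | zero => simpa [h0] using D1_raisingDerivation hp
  | succ m ih =>
    rw [Function.iterate_succ_apply',
      D1_raisingDerivation (raisingDerivation_iterate_isWeightedHomogeneous hp (m + 1)), ih,
      Derivation.map_smul, ← Function.iterate_succ_apply' (raisingDerivation d) m, ← add_smul]
    congr 1
    push_cast; ring

theorem abs_weight_formWeight_le (s : Fin (d + 1) →₀ ℕ) :
    |Finsupp.weight (formWeight d) s| ≤ d * s.degree := by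
  rw [Finsupp.weight_apply, Finsupp.sum, Finsupp.degree_apply, Nat.cast_sum, Finset.mul_sum]
  refine (Finset.abs_sum_le_sum_abs _ _).trans (Finset.sum_le_sum fun i _ => ?_)
  rw [nsmul_eq_mul, abs_mul, mul_comm, Nat.abs_cast]
  refine mul_le_mul_of_nonneg_right ?_ (by positivity)
  rw [formWeight, abs_le]
  omega

theorem eq_zero_of_lt_abs_formWeight (hn : p.IsHomogeneous n)
    (hp : p.IsWeightedHomogeneous (formWeight d) h) (hh : (d * n : ℤ) < |h|) : p = 0 := by
  ext s
  by_contra hs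
  have h1 := abs_weight_formWeight_le s
  rw [hp hs, Finsupp.degree_eq_weight_one] at h1
  have h2 : Finsupp.weight 1 s = n := hn hs
  change |h| ≤ d * (Finsupp.weight 1 s : ℕ) at h1
  rw [h2] at h1
  omega

theorem exists_D1_iterate_eq_zero (hn : p.IsHomogeneous n)
    (hp : p.IsWeightedHomogeneous (formWeight d) h) : ∃ m, (D1 d)^[m] p = 0 := by
  refine ⟨d * n + h.natAbs + 1, eq_zero_of_lt_abs_formWeight (n := n) ?_
    (D1_iterate_isWeightedHomogeneous hp _) (lt_of_lt_of_le ?_ (le_abs_self _))⟩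
  · exact Function.Iterate.rec (fun q => IsHomogeneous q n) hn (fun _ => D1_isHomogeneous) _
  · have := Int.mul_nonneg (Int.natCast_nonneg d) (Int.natCast_nonneg n)
    push_cast
    have := neg_abs_le h
    have := abs_nonneg h
    linarith

theorem exists_raisingDerivation_iterate_eq_zero (hn : p.IsHomogeneous n)
    (hp : p.IsWeightedHomogeneous (formWeight d) h) :
    ∃ m, (raisingDerivation d)^[m] p = 0 := by
  refine ⟨d * n + h.natAbs + 1, eq_zero_of_lt_abs_formWeight (n := n) ?_
    (raisingDerivation_iterate_isWeightedHomogeneous hp _) (lt_of_lt_of_le ?_ (neg_le_abs _))⟩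
  · exact Function.Iterate.rec (fun q => IsHomogeneous q n) hn
      (fun _ => raisingDerivation_isHomogeneous) _
  · have := Int.mul_nonneg (Int.natCast_nonneg d) (Int.natCast_nonneg n)
    push_cast
    have := le_abs_self h
    have := abs_nonneg h
    linarith

theorem eq_zero_of_D1_eq_zero (hn : p.IsHomogeneous n)
    (hp : p.IsWeightedHomogeneous (formWeight d) h) (hh : h < 0) (h0 : D1 d p = 0) : p = 0 := by
  obtain ⟨m, hm⟩ := exists_raisingDerivation_iterate_eq_zero hn hp
  induction m with
  | zero => exact hm
  | succ m ih =>
    refine ih ?_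
    have := D1_raisingDerivation_iterate hp h0 m
    rw [hm, map_zero, eq_comm, smul_eq_zero] at this
    refine this.resolve_left (mul_ne_zero m.cast_add_one_ne_zero ?_)
    exact_mod_cast (show h - m ≠ 0 by omega)

theorem exists_D1_eq (hn : p.IsHomogeneous n)
    (hp : p.IsWeightedHomogeneous (formWeight d) h) (hh : 0 < h) :
    ∃ q : MvPolynomial (Fin (d + 1)) ℂ, q.IsHomogeneous n ∧
      q.IsWeightedHomogeneous (formWeight d) (h + -2) ∧ D1 d q = p := by
  obtain ⟨m, hm⟩ := exists_D1_iterate_eq_zero hn hp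
  induction m generalizing p with
  | zero =>
    exact ⟨0, isHomogeneous_zero _ _ _, isWeightedHomogeneous_zero _ _ _, by
      rw [map_zero]; exact hm.symm⟩
  | succ m ih =>
    have hc : ((m + 1) * (h + m) : ℂ) ≠ 0 := by
      refine mul_ne_zero m.cast_add_one_ne_zero ?_
      exact_mod_cast (show h + m ≠ 0 by omega)
    set c : ℂ := (m + 1) * (h + m) with hc_def
    have hE := raisingDerivation_isWeightedHomogeneous hp
    have hDE := D1_isWeightedHomogeneous hE
    rw [neg_add_cancel_right] at hDE
    obtain ⟨q, hq, hqw, hDq⟩ := ih (p := D1 d (raisingDerivation d p) - c • p)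
      ((D1_isHomogeneous (raisingDerivation_isHomogeneous hn)).sub
        ((homogeneousSubmodule _ ℂ n).smul_mem c hn))
      (hDE.sub ((weightedHomogeneousSubmodule ℂ _ _).smul_mem c hp)) (by
        have := D1_iterate_raisingDerivation hp m
        rw [hm, map_zero, zero_add, Function.iterate_succ_apply] at this
        have hlin : ∀ q, (D1 d)^[m] q = ((D1 d).toLinearMap ^ m) q := fun q => by
          rw [Module.End.pow_apply]; rfl
        rw [hlin] at this ⊢
        rw [map_sub, this, map_smul, hlin, sub_self])
    refine ⟨c⁻¹ • (raisingDerivation d p - q),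
      (homogeneousSubmodule _ ℂ n).smul_mem _ ((raisingDerivation_isHomogeneous hn).sub hq),
      (weightedHomogeneousSubmodule ℂ _ _).smul_mem _ (hE.sub hqw), ?_⟩
    rw [Derivation.map_smul, map_sub, hDq, sub_sub_cancel, smul_smul, inv_mul_cancel₀ hc, one_smul]

end Sl2

section SeminvariantDimension

open MvPolynomial

/-- The exponents of the monomials of degree `n` in `x_0, …, x_d` whose weight satisfies `P`. -/
def formExponents (d n : ℕ) (P : ℤ → Prop) [DecidablePred P] : Finset (Fin (d + 1) →₀ ℕ) :=
  (Finset.finsuppAntidiag Finset.univ n).filter fun s => P (Finsupp.weight (formWeight d) s)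

theorem mem_formExponents {d n : ℕ} {P : ℤ → Prop} [DecidablePred P] {s : Fin (d + 1) →₀ ℕ} :
    s ∈ formExponents d n P ↔ s.degree = n ∧ P (Finsupp.weight (formWeight d) s) := by
  simp [formExponents, Finset.mem_finsuppAntidiag, Finsupp.degree_eq_sum]

theorem IsHomogeneous.mem_restrictSupport_formExponents {d n : ℕ} {P : ℤ → Prop}
    [DecidablePred P] {h : ℤ} {p : MvPolynomial (Fin (d + 1)) ℂ} (hn : p.IsHomogeneous n)
    (hp : p.IsWeightedHomogeneous (formWeight d) h) (hh : P h) :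
    p ∈ restrictSupport ℂ (formExponents d n P : Set (Fin (d + 1) →₀ ℕ)) := by
  refine (mem_restrictSupport_iff ℂ).2 fun s hs => mem_formExponents.2 ?_
  have hs := mem_support_iff.1 (Finset.mem_coe.1 hs)
  rw [hp hs, Finsupp.degree_eq_weight_one]
  exact ⟨hn hs, hh⟩

theorem map_D1_restrictSupport (d n : ℕ) :
    (restrictSupport ℂ (formExponents d n (0 ≤ ·) : Set (Fin (d + 1) →₀ ℕ))).map
      (D1 d).toLinearMap =
    restrictSupport ℂ (formExponents d n (2 ≤ ·) : Set (Fin (d + 1) →₀ ℕ)) := by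
  have hmon : ∀ s ∈ formExponents d n (fun _ => True),
      (monomial s (1 : ℂ)).IsHomogeneous n ∧ (monomial s (1 : ℂ)).IsWeightedHomogeneous
        (formWeight d) (Finsupp.weight (formWeight d) s) := fun s hs =>
    ⟨isHomogeneous_monomial _ (mem_formExponents.1 hs).1,
      isWeightedHomogeneous_monomial _ _ _ rfl⟩
  apply le_antisymm
  · rw [restrictSupport_eq_span, Submodule.map_span_le]
    rintro _ ⟨s, hs, rfl⟩
    have hs := mem_formExponents.1 (Finset.mem_coe.1 hs)
    obtain ⟨hsn, hsw⟩ := hmon s (mem_formExponents.2 ⟨hs.1, trivial⟩)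
    exact IsHomogeneous.mem_restrictSupport_formExponents (D1_isHomogeneous hsn)
      (D1_isWeightedHomogeneous hsw) (by linarith [hs.2])
  · rw [restrictSupport_eq_span ℂ (formExponents d n (2 ≤ ·) : Set (Fin (d + 1) →₀ ℕ)), Submodule.span_le]
    rintro _ ⟨s, hs, rfl⟩
    have hs := mem_formExponents.1 (Finset.mem_coe.1 hs)
    obtain ⟨hsn, hsw⟩ := hmon s (mem_formExponents.2 ⟨hs.1, trivial⟩)
    obtain ⟨q, hq, hqw, hDq⟩ := exists_D1_eq hsn hsw (by linarith [hs.2])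
    exact ⟨q, IsHomogeneous.mem_restrictSupport_formExponents hq hqw (by linarith [hs.2]), hDq⟩

theorem Sn_le_restrictSupport (d n : ℕ) :
    Sn d n ≤ restrictSupport ℂ (formExponents d n (0 ≤ ·) : Set (Fin (d + 1) →₀ ℕ)) := by
  rintro p ⟨hn, hD⟩
  refine (mem_restrictSupport_iff ℂ).2 fun s hs => mem_formExponents.2 ?_
  have hs := mem_support_iff.1 (Finset.mem_coe.1 hs)
  refine ⟨by rw [Finsupp.degree_eq_weight_one]; exact hn hs, ?_⟩
  by_contra! hneg
  set h := Finsupp.weight (formWeight d) s with hh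
  have h0 : weightedHomogeneousComponent (formWeight d) h p = 0 := by
    refine eq_zero_of_D1_eq_zero (n := n) ?_
      (weightedHomogeneousComponent_isWeightedHomogeneous h p) hneg ?_
    · intro t ht
      rw [coeff_weightedHomogeneousComponent] at ht
      exact hn fun h0 => ht (by rw [h0, ite_self])
    · have hD : D1 d p = 0 := hD
      rw [D1, mkDerivation_weightedHomogeneousComponent val_smul_X_isWeightedHomogeneous, ← D1,
        hD, map_zero]
  apply hs
  have := congrArg (coeff s) h0
  rwa [coeff_weightedHomogeneousComponent, if_pos hh.symm, coeff_zero] at this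

/-- The dimension of the space of seminvariants of degree `n` of the binary `d`-form is the number
of monomials of degree `n` and weight `0` or `1` (the Cayley–Sylvester formula). -/
theorem finrank_Sn (d n : ℕ) :
    Module.finrank ℂ (Sn d n) = (formExponents d n fun h => h = 0 ∨ h = 1).card := by
  set A := restrictSupport ℂ (formExponents d n (0 ≤ ·) : Set (Fin (d + 1) →₀ ℕ)) with hA
  have hfin : Module.Finite ℂ A := Module.Finite.of_basis (basisRestrictSupport ℂ _)
  have hrank := ((D1 d).toLinearMap.domRestrict A).finrank_range_add_finrank_ker
  have hker : LinearMap.ker ((D1 d).toLinearMap.domRestrict A) = (Sn d n).comap A.subtype := by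
    ext ⟨p, hp⟩
    simp only [LinearMap.mem_ker, LinearMap.domRestrict_apply, Submodule.mem_comap,
      Submodule.subtype_apply, Sn, Submodule.mem_inf, mem_homogeneousSubmodule, iff_and_self]
    intro _ s hs
    have := (mem_formExponents.1 ((mem_restrictSupport_iff ℂ).1 hp (mem_support_iff.2 hs))).1
    rwa [Finsupp.degree_eq_weight_one] at this
  rw [LinearMap.range_domRestrict, map_D1_restrictSupport, finrank_restrictSupport,
    finrank_restrictSupport, hker,
    (Submodule.comapSubtypeEquivOfLe (Sn_le_restrictSupport d n)).finrank_eq] at hrank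
  have hdisj : Disjoint (formExponents d n (2 ≤ ·)) (formExponents d n fun h => h = 0 ∨ h = 1) := by
    rw [Finset.disjoint_left]
    intro s h1 h2
    have := (mem_formExponents.1 h1).2
    have := (mem_formExponents.1 h2).2
    omega
  have hunion : formExponents d n (0 ≤ ·) =
      (formExponents d n (2 ≤ ·)).disjUnion (formExponents d n fun h => h = 0 ∨ h = 1) hdisj := by
    ext s
    simp only [Finset.mem_disjUnion, mem_formExponents, ← and_or_left]
    refine and_congr_right fun _ => ?_
    omega
  rw [hunion, Finset.card_disjUnion] at hrank
  omega

end SeminvariantDimension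

section ConstantTerm

/-- The numerator of the Poincaré series of the covariants of the binary sextic. -/
def sexticNumerator {R : Type*} [CommRing R] (z : R) : R :=
  1 + z ^ 2 + 3 * z ^ 3 + 4 * z ^ 4 + 4 * z ^ 5 + 4 * z ^ 6 + 3 * z ^ 7 + z ^ 8 + z ^ 10

/-- The numerator, up to a factor depending on `z` only, of the part with nonnegative powers of `t`
in the partial fraction decomposition of `∏ (1 - t ^ j z)⁻¹` over `j = ±1, ±2, ±3`. -/
def sexticPartialFraction {R : Type*} [CommRing R] (z t : R) : R :=
  sexticNumerator z +
  (2 * z ^ 2 + 2 * z ^ 3 - z ^ 6 - z ^ 7 - z ^ 8 - z ^ 11) * t +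
  (z ^ 2 - z ^ 3 - 2 * z ^ 4 - 3 * z ^ 5 - 4 * z ^ 6 - 5 * z ^ 7 - 4 * z ^ 8 - 2 * z ^ 9 -
    z ^ 10 - z ^ 11) * t ^ 2 +
  (-2 * z ^ 3 - 3 * z ^ 4 - 4 * z ^ 5 - 4 * z ^ 6 - 4 * z ^ 7 - 3 * z ^ 8 - z ^ 9 - z ^ 10 -
    z ^ 11 + z ^ 12) * t ^ 3 +
  (-z ^ 3 - z ^ 4 - z ^ 5 - z ^ 6 + z ^ 8 + z ^ 9 + z ^ 11 + z ^ 12) * t ^ 4 +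
  (z ^ 4 + 2 * z ^ 5 + 3 * z ^ 6 + 3 * z ^ 7 + 4 * z ^ 8 + 3 * z ^ 9 + 3 * z ^ 10 + 2 * z ^ 11 +
    z ^ 12) * t ^ 5

theorem map_sexticNumerator {R S : Type*} [CommRing R] [CommRing S] (f : R →+* S) (z : R) :
    f (sexticNumerator z) = sexticNumerator (f z) := by
  simp [sexticNumerator, map_ofNat f]

theorem map_sexticPartialFraction {R S : Type*} [CommRing R] [CommRing S] (f : R →+* S)
    (z t : R) : f (sexticPartialFraction z t) = sexticPartialFraction (f z) (f t) := by
  simp [sexticPartialFraction, map_sexticNumerator, map_ofNat f]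

theorem sextic_partial_fractions {R : Type*} [CommRing R] {z t t' : R} (ht : t * t' = 1) :
    (1 - z ^ 2) ^ 2 * (1 - z ^ 3) * (1 - z ^ 4) * (1 - z ^ 5) =
      sexticPartialFraction z t * ((1 - t' * z) * (1 - t' ^ 2 * z) * (1 - t' ^ 3 * z)) +
      sexticPartialFraction z t' * ((1 - t * z) * (1 - t ^ 2 * z) * (1 - t ^ 3 * z)) -
      sexticNumerator z * (((1 - t * z) * (1 - t ^ 2 * z) * (1 - t ^ 3 * z)) *
        ((1 - t' * z) * (1 - t' ^ 2 * z) * (1 - t' ^ 3 * z))) := by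
  have hk : ∀ k : ℕ, t ^ k * t' ^ k = 1 := fun k => by rw [← mul_pow, ht, one_pow]
  have hQ : t ^ 6 * ((1 - t' * z) * (1 - t' ^ 2 * z) * (1 - t' ^ 3 * z)) =
      (t - z) * (t ^ 2 - z) * (t ^ 3 - z) := by
    have h1 : t * (1 - t' * z) = t - z := by linear_combination (-z) * ht
    have h2 : t ^ 2 * (1 - t' ^ 2 * z) = t ^ 2 - z := by linear_combination (-z) * hk 2
    have h3 : t ^ 3 * (1 - t' ^ 3 * z) = t ^ 3 - z := by linear_combination (-z) * hk 3
    rw [← h1, ← h2, ← h3]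
    ring
  have hA : t ^ 6 * sexticPartialFraction z t' =
      sexticNumerator z * t ^ 6 +
      (2 * z ^ 2 + 2 * z ^ 3 - z ^ 6 - z ^ 7 - z ^ 8 - z ^ 11) * t ^ 5 +
      (z ^ 2 - z ^ 3 - 2 * z ^ 4 - 3 * z ^ 5 - 4 * z ^ 6 - 5 * z ^ 7 - 4 * z ^ 8 - 2 * z ^ 9 -
        z ^ 10 - z ^ 11) * t ^ 4 +
      (-2 * z ^ 3 - 3 * z ^ 4 - 4 * z ^ 5 - 4 * z ^ 6 - 4 * z ^ 7 - 3 * z ^ 8 - z ^ 9 - z ^ 10 -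
        z ^ 11 + z ^ 12) * t ^ 3 +
      (-z ^ 3 - z ^ 4 - z ^ 5 - z ^ 6 + z ^ 8 + z ^ 9 + z ^ 11 + z ^ 12) * t ^ 2 +
      (z ^ 4 + 2 * z ^ 5 + 3 * z ^ 6 + 3 * z ^ 7 + 4 * z ^ 8 + 3 * z ^ 9 + 3 * z ^ 10 +
        2 * z ^ 11 + z ^ 12) * t := by
    unfold sexticPartialFraction
    linear_combination
      (2 * z ^ 2 + 2 * z ^ 3 - z ^ 6 - z ^ 7 - z ^ 8 - z ^ 11) * t ^ 5 * hk 1 +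
      (z ^ 2 - z ^ 3 - 2 * z ^ 4 - 3 * z ^ 5 - 4 * z ^ 6 - 5 * z ^ 7 - 4 * z ^ 8 - 2 * z ^ 9 -
        z ^ 10 - z ^ 11) * t ^ 4 * hk 2 +
      (-2 * z ^ 3 - 3 * z ^ 4 - 4 * z ^ 5 - 4 * z ^ 6 - 4 * z ^ 7 - 3 * z ^ 8 - z ^ 9 - z ^ 10 -
        z ^ 11 + z ^ 12) * t ^ 3 * hk 3 +
      (-z ^ 3 - z ^ 4 - z ^ 5 - z ^ 6 + z ^ 8 + z ^ 9 + z ^ 11 + z ^ 12) * t ^ 2 * hk 4 +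
      (z ^ 4 + 2 * z ^ 5 + 3 * z ^ 6 + 3 * z ^ 7 + 4 * z ^ 8 + 3 * z ^ 9 + 3 * z ^ 10 +
        2 * z ^ 11 + z ^ 12) * t * hk 5
  have h6 : IsUnit (t ^ 6) := IsUnit.of_mul_eq_one _ (hk 6)
  refine h6.mul_left_cancel ?_
  rw [mul_sub (t ^ 6) (_ + _), mul_add (t ^ 6), mul_left_comm _ (sexticPartialFraction z t), hQ,
    ← mul_assoc (t ^ 6) (sexticPartialFraction z t'), hA,
    mul_left_comm _ (sexticNumerator z),
    mul_left_comm (t ^ 6) ((1 - t * z) * _ * _), hQ]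
  unfold sexticPartialFraction sexticNumerator
  ring

open PowerSeries LaurentPolynomial

/-- The power series of constant terms of a power series of Laurent polynomials. -/
def constantTerm (φ : PowerSeries ℂ[T;T⁻¹]) : PowerSeries ℂ :=
  PowerSeries.mk fun n => (coeff n φ).coeff 0

theorem constantTerm_add (φ ψ : PowerSeries ℂ[T;T⁻¹]) :
    constantTerm (φ + ψ) = constantTerm φ + constantTerm ψ := by
  ext n; simp [constantTerm]

theorem constantTerm_sub (φ ψ : PowerSeries ℂ[T;T⁻¹]) :
    constantTerm (φ - ψ) = constantTerm φ - constantTerm ψ := by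
  ext n; simp [constantTerm]

theorem constantTerm_map_C_mul (r : PowerSeries ℂ) (φ : PowerSeries ℂ[T;T⁻¹]) :
    constantTerm (PowerSeries.map LaurentPolynomial.C r * φ) = r * constantTerm φ := by
  ext n
  simp only [constantTerm, coeff_mk, PowerSeries.coeff_mul, PowerSeries.coeff_map,
    AddMonoidAlgebra.coeff_sum, Finsupp.finsetSum_apply, ← LaurentPolynomial.smul_eq_C_mul]
  simp

theorem constantTerm_map_toLaurent (φ : PowerSeries (Polynomial ℂ)) :
    constantTerm (PowerSeries.map Polynomial.toLaurent φ) =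
      PowerSeries.map Polynomial.constantCoeff φ := by
  ext n
  rw [constantTerm, coeff_mk, PowerSeries.coeff_map, PowerSeries.coeff_map, coeff_toLaurent]
  exact Finsupp.mapDomain_apply Nat.cast_injective _ 0

theorem constantTerm_map_invert (φ : PowerSeries ℂ[T;T⁻¹]) :
    constantTerm (PowerSeries.map (LaurentPolynomial.invert (R := ℂ) : ℂ[T;T⁻¹] →+* ℂ[T;T⁻¹]) φ) =
      constantTerm φ := by
  ext n; simp [constantTerm]

/-- The geometric series `∑ aᵏ zᵏ`. -/
def geomSeries {R : Type*} [Semiring R] (a : R) : PowerSeries R :=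
  PowerSeries.mk fun k => a ^ k

theorem geomSeries_mul_one_sub {R : Type*} [CommRing R] (a : R) :
    geomSeries a * (1 - PowerSeries.C a * PowerSeries.X) = 1 := by
  have h := congrArg (rescale a) (PowerSeries.mk_one_mul_one_sub_eq_one R)
  rwa [map_mul, map_sub, map_one, rescale_X, rescale_mk,
    show (PowerSeries.mk fun n => a ^ n * (1 : ℕ → R) n) = geomSeries a by simp [geomSeries]] at h

theorem map_geomSeries {R S : Type*} [Semiring R] [Semiring S] (f : R →+* S) (a : R) :
    PowerSeries.map f (geomSeries a) = geomSeries (f a) := by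
  ext n; simp [geomSeries]

theorem constantTerm_prod_geomSeries {ι : Type*} [Fintype ι] [DecidableEq ι] (w : ι → ℤ) (n : ℕ) :
    coeff n (constantTerm (∏ i, geomSeries (T (w i)))) =
      (((Finset.univ : Finset ι).finsuppAntidiag n).filter
        fun s => Finsupp.weight w s = 0).card := by
  rw [constantTerm, coeff_mk, PowerSeries.coeff_prod, AddMonoidAlgebra.coeff_sum,
    Finsupp.finsetSum_apply, Finset.card_filter, Nat.cast_sum]
  refine Finset.sum_congr rfl fun s _ => ?_
  have hT : ∏ i, coeff (s i) (geomSeries (T (w i) : ℂ[T;T⁻¹])) = T (Finsupp.weight w s) := by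
    rw [Finsupp.weight_apply, Finsupp.sum_fintype _ _ (by simp)]
    have : ∀ u : Finset ι, ∏ i ∈ u, coeff (s i) (geomSeries (T (w i) : ℂ[T;T⁻¹])) =
        T (∑ i ∈ u, s i • w i) := fun u => by
      induction u using Finset.induction_on with
      | empty => simp
      | insert i u hi ih =>
        rw [Finset.prod_insert hi, Finset.sum_insert hi, T_add, ih]
        rw [geomSeries, coeff_mk, T_pow, nsmul_eq_mul]
    exact this _
  rw [hT, T_apply]
  simp

theorem constantTerm_sextic :
    (1 - X) * (1 - X ^ 2) ^ 2 * (1 - X ^ 3) * (1 - X ^ 4) * (1 - X ^ 5) *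
      constantTerm (∏ i : Fin 7, geomSeries (T (3 - i.val))) =
    sexticNumerator (X : PowerSeries ℂ) := by
  set t : PowerSeries ℂ[T;T⁻¹] := PowerSeries.C (T 1) with ht
  set t' : PowerSeries ℂ[T;T⁻¹] := PowerSeries.C (T (-1)) with ht'
  set A := sexticPartialFraction (X : PowerSeries ℂ[T;T⁻¹]) t with hA
  set A' := sexticPartialFraction (X : PowerSeries ℂ[T;T⁻¹]) t' with hA'
  set p : PowerSeries ℂ[T;T⁻¹] := geomSeries (T 1) * geomSeries (T 2) * geomSeries (T 3) with hp
  set q : PowerSeries ℂ[T;T⁻¹] :=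
    geomSeries (T (-1)) * geomSeries (T (-2)) * geomSeries (T (-3)) with hq
  have htt : t * t' = 1 := by
    rw [ht, ht', ← map_mul, ← T_add, add_neg_cancel, T_zero, map_one]
  have hgeom : ∀ (n : ℤ) (k : ℕ) (m : ℤ), k * n = m →
      geomSeries (T m : ℂ[T;T⁻¹]) * (1 - PowerSeries.C (T n) ^ k * X) = 1 := fun n k m h => by
    rw [← map_pow, T_pow, h, geomSeries_mul_one_sub]
  have hP : p * ((1 - t * X) * (1 - t ^ 2 * X) * (1 - t ^ 3 * X)) = 1 := by
    have h1 := hgeom 1 1 1 (by norm_num)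
    have h2 := hgeom 1 2 2 (by norm_num)
    have h3 := hgeom 1 3 3 (by norm_num)
    rw [pow_one] at h1
    rw [hp, mul_mul_mul_comm, mul_mul_mul_comm (geomSeries _), h1, h2, h3, one_mul, one_mul]
  have hQ : q * ((1 - t' * X) * (1 - t' ^ 2 * X) * (1 - t' ^ 3 * X)) = 1 := by
    have h1 := hgeom (-1) 1 (-1) (by norm_num)
    have h2 := hgeom (-1) 2 (-2) (by norm_num)
    have h3 := hgeom (-1) 3 (-3) (by norm_num)
    rw [pow_one] at h1
    rw [hq, mul_mul_mul_comm, mul_mul_mul_comm (geomSeries _), h1, h2, h3, one_mul, one_mul]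
  have h0 : geomSeries (T 0 : ℂ[T;T⁻¹]) * (1 - X) = 1 := by
    simpa using geomSeries_mul_one_sub (T 0 : ℂ[T;T⁻¹])
  have hprod : ∏ i : Fin 7, geomSeries (T (3 - i.val) : ℂ[T;T⁻¹]) =
      p * geomSeries (T 0) * q := by
    simp only [Fin.prod_univ_succ, Fin.prod_univ_zero, Fin.val_zero, Fin.val_succ]
    norm_num [hp, hq]
    ring
  have hCTp : constantTerm (A * p) = sexticNumerator X := by
    have : A * p = PowerSeries.map Polynomial.toLaurent
        (sexticPartialFraction X (PowerSeries.C Polynomial.X) * (geomSeries Polynomial.X *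
          geomSeries (Polynomial.X ^ 2) * geomSeries (Polynomial.X ^ 3))) := by
      simp [hA, hp, ht, map_sexticPartialFraction, map_geomSeries]
    rw [this, constantTerm_map_toLaurent]
    have h0 : geomSeries (0 : ℂ) = 1 := by simpa using geomSeries_mul_one_sub (0 : ℂ)
    simp [sexticPartialFraction, map_sexticNumerator, map_geomSeries, h0]
  have hCTq : constantTerm (A' * q) = sexticNumerator X := by
    rw [← hCTp, ← constantTerm_map_invert]
    congr 1
    simp [hA, hA', hp, hq, ht, ht', map_sexticPartialFraction, map_geomSeries]
  have hCT1 : constantTerm (sexticNumerator X) = sexticNumerator X := by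
    have : (sexticNumerator X : PowerSeries ℂ[T;T⁻¹]) =
        PowerSeries.map LaurentPolynomial.C (sexticNumerator X) * 1 := by
      rw [map_sexticNumerator, map_X, mul_one]
    rw [this, constantTerm_map_C_mul]
    have h1 : constantTerm 1 = 1 := by
      ext n
      rw [constantTerm, coeff_mk, PowerSeries.coeff_one, PowerSeries.coeff_one, ← T_zero]
      split_ifs <;> simp
    rw [h1, mul_one]
  have key : PowerSeries.map LaurentPolynomial.C
      ((1 - X) * (1 - X ^ 2) ^ 2 * (1 - X ^ 3) * (1 - X ^ 4) * (1 - X ^ 5)) *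
        ∏ i : Fin 7, geomSeries (T (3 - i.val)) = A * p + A' * q - sexticNumerator X := by
    have hpf := sextic_partial_fractions (z := (X : PowerSeries ℂ[T;T⁻¹])) htt
    rw [← hA, ← hA'] at hpf
    rw [hprod]
    simp only [map_mul, map_sub, map_pow, map_one, map_X]
    generalize (1 - t * X) * (1 - t ^ 2 * X) * (1 - t ^ 3 * X) = P at *
    generalize (1 - t' * X) * (1 - t' ^ 2 * X) * (1 - t' ^ 3 * X) = Q at *
    linear_combination (geomSeries (T 0) * (1 - X) * p * q) * hpf +
      (p * q * (A * Q + A' * P - sexticNumerator X * (P * Q))) * h0 +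
      (A' * q - sexticNumerator X * q * Q) * hP + (A * p - sexticNumerator X) * hQ
  rw [← constantTerm_map_C_mul, key, constantTerm_sub, constantTerm_add, hCTp, hCTq, hCT1,
    add_sub_cancel_right]

end ConstantTerm

theorem formWeight_six : formWeight 6 = fun i => 2 * (3 - (i.val : ℤ)) := by
  ext i
  rw [formWeight]
  push_cast
  ring

theorem card_formExponents_six (n : ℕ) :
    ((formExponents 6 n fun h => h = 0 ∨ h = 1).card : ℂ) =
      PowerSeries.coeff n (constantTerm
        (∏ i : Fin 7, geomSeries (LaurentPolynomial.T (3 - i.val)))) := by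
  rw [constantTerm_prod_geomSeries, formExponents]
  congr 2
  refine Finset.filter_congr fun s _ => ?_
  have h2 : Finsupp.weight (formWeight 6) s =
      2 * Finsupp.weight (fun i : Fin 7 => 3 - (i.val : ℤ)) s := by
    simp only [Finsupp.weight_apply, Finsupp.sum, Finset.mul_sum, formWeight_six]
    refine Finset.sum_congr rfl fun i _ => ?_
    rw [mul_smul_comm]
  rw [h2]
  omega

/-- The Poincaré series of the algebra of covariants of the binary 6-form. -/
theorem poincare_series_d6 :
    PSeries 6 = (1 + (PowerSeries.X : PowerSeries ℂ) ^ 2 + 3 * (PowerSeries.X : PowerSeries ℂ) ^ 3 + 4 * (PowerSeries.X : PowerSeries ℂ) ^ 4 + 4 * (PowerSeries.X : PowerSeries ℂ) ^ 5 + 4 * (PowerSeries.X : PowerSeries ℂ) ^ 6 + 3 * (PowerSeries.X : PowerSeries ℂ) ^ 7 + (PowerSeries.X : PowerSeries ℂ) ^ 8 + (PowerSeries.X : PowerSeries ℂ) ^ 10) * ((1 - (PowerSeries.X : PowerSeries ℂ)) * (1 - (PowerSeries.X : PowerSeries ℂ) ^ 2) ^ 2 * (1 - (PowerSeries.X : PowerSeries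 ℂ) ^ 3) * (1 - (PowerSeries.X : PowerSeries ℂ) ^ 4) * (1 - (PowerSeries.X : PowerSeries ℂ) ^ 5))⁻¹ := by
  have hseries : PSeries 6 = constantTerm
      (∏ i : Fin 7, geomSeries (LaurentPolynomial.T (3 - i.val))) := by
    ext n
    rw [PSeries, PowerSeries.coeff_mk, finrank_Sn, card_formExponents_six]
  rw [PowerSeries.eq_mul_inv_iff_mul_eq (by simp), hseries, mul_comm]
  exact constantTerm_sextic

end
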